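/- Let 1 ≤ d < n be integers, α₀ ∈ ℝ^{n−d}, A ∈ ℝ^{d×(n−d)}, Ã the (d+1)×(n−d) matrix with first row α₀ and remaining rows A, and H = {(x, (1,x)·Ã) : x ∈ ℝ^d} ⊆ ℝ^n. Let 0 < s ≤ d be real and let ψ: ℕ → ℝ_{≥0} be a non-increasing approximation function. If ∑_{q=1}^∞ ψ(q)^{n−d+s} q^{d−s} < ∞ and the multiplicative diophantine type satisfies ω(Ã) < (d+1)(n−d+s)/(d+1−s), then the s-dimensional Hausdorff measure of S_n(ψ) ∩ H is zero. -/

import Mathlib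

open MeasureTheory
open scoped ENNReal NNReal

/-- Distance to the nearest integer. -/
noncomputable def dNI (y : ℝ) : ℝ := |y - round y|

/-- Supremum norm of an integer vector, as a natural number. -/
def jnorm {m : ℕ} (j : Fin m → ℤ) : ℕ := Finset.univ.sup fun i => (j i).natAbs

/-- The multiplicative diophantine type `ω(M)` of a matrix `M ∈ ℝ^{l×m}`:
the least upper bound of all `ω > 0` such that
`∏_{u=1}^l ‖j ⬝ row_u M‖ < |j|^{-ω}` has infinitely many solutions `j ∈ ℤ^m`. -/
noncomputable def multType {l m : ℕ} (M : Matrix (Fin l) (Fin m) ℝ) : ℝ≥0∞ :=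
  sSup {w : ℝ≥0∞ | ∃ ω : ℝ, 0 < ω ∧ w = ENNReal.ofReal ω ∧
    {j : Fin m → ℤ | j ≠ 0 ∧
      (∏ u, dNI (∑ v, (j v : ℝ) * M u v)) < (jnorm j : ℝ) ^ (-ω)}.Infinite}

lemma dNI_nonneg (y : ℝ) : 0 ≤ dNI y := abs_nonneg _

lemma dNI_le_half (y : ℝ) : dNI y ≤ 1 / 2 := abs_sub_round y

lemma dNI_le_abs_sub_intCast (y : ℝ) (z : ℤ) : dNI y ≤ |y - z| := round_le y z

lemma dNI_le_abs_sub_add (y y' : ℝ) : dNI y ≤ |y - y'| + dNI y' := by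
  refine (dNI_le_abs_sub_intCast y (round y')).trans ?_
  unfold dNI
  have : y - (round y' : ℝ) = (y - y') + (y' - round y') := by ring
  rw [this]
  exact abs_add_le _ _

lemma dNI_sub_le (y y' : ℝ) : dNI (y - y') ≤ |(y - round y) - (y' - round y')| := by
  refine (dNI_le_abs_sub_intCast (y - y') (round y - round y')).trans (le_of_eq ?_)
  push_cast
  congr 1
  ring

lemma dNI_intCast_mul_eq_zero {y : ℝ} (h : dNI y = 0) (k : ℤ) : dNI (k * y) = 0 := by
  have h1 : y = round y := by
    unfold dNI at h
    linarith [abs_eq_zero.mp h]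
  refine le_antisymm ?_ (dNI_nonneg _)
  refine (dNI_le_abs_sub_intCast _ (k * round y)).trans (le_of_eq ?_)
  push_cast
  rw [← h1, sub_self, abs_zero]

/-- The standard additive character `θ ↦ exp(2πiθ)` of `ℝ`. -/
noncomputable def expChar (θ : ℝ) : ℂ := Complex.exp ((2 * Real.pi * θ : ℝ) * Complex.I)

lemma expChar_add (a b : ℝ) : expChar (a + b) = expChar a * expChar b := by
  unfold expChar
  rw [← Complex.exp_add]
  congr 1
  push_cast
  ring

lemma expChar_sum {ι : Type*} (s : Finset ι) (f : ι → ℝ) :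
    expChar (∑ i ∈ s, f i) = ∏ i ∈ s, expChar (f i) := by
  unfold expChar
  rw [← Complex.exp_sum]
  congr 1
  push_cast
  rw [Finset.mul_sum, Finset.sum_mul]

lemma norm_expChar (θ : ℝ) : ‖expChar θ‖ = 1 := Complex.norm_exp_ofReal_mul_I _

lemma conj_expChar (θ : ℝ) : (starRingEnd ℂ) (expChar θ) = expChar (-θ) := by
  unfold expChar
  rw [← Complex.exp_conj]
  congr 1
  rw [map_mul, Complex.conj_ofReal, Complex.conj_I]
  push_cast
  ring

lemma re_expChar (θ : ℝ) : (expChar θ).re = Real.cos (2 * Real.pi * θ) :=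
  Complex.exp_ofReal_mul_I_re _

lemma expChar_intCast (k : ℤ) : expChar k = 1 := by
  unfold expChar
  rw [Complex.exp_eq_one_iff]
  exact ⟨k, by push_cast; ring⟩

lemma norm_expChar_sub_one (θ : ℝ) : ‖expChar θ - 1‖ = 2 * |Real.sin (Real.pi * θ)| := by
  unfold expChar
  rw [mul_comm, Complex.norm_exp_I_mul_ofReal_sub_one, Real.norm_eq_abs, abs_mul,
    abs_of_pos (by norm_num : (0 : ℝ) < 2)]
  congr 3
  ring

lemma four_mul_dNI_le (θ : ℝ) : 4 * dNI θ ≤ ‖expChar θ - 1‖ := by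
  have h1 : expChar θ = expChar (θ - round θ) := by
    have : θ = (θ - round θ) + (round θ : ℤ) := by ring
    conv_lhs => rw [this, expChar_add, expChar_intCast, mul_one]
  rw [h1, norm_expChar_sub_one]
  unfold dNI
  set y := θ - round θ with hy
  have hy2 : |y| ≤ 1 / 2 := abs_sub_round θ
  have h2 := Real.mul_abs_le_abs_sin (x := Real.pi * y) (by
    rw [abs_mul, abs_of_pos Real.pi_pos]
    nlinarith [Real.pi_pos])
  rw [abs_mul, abs_of_pos Real.pi_pos, ← mul_assoc, div_mul_cancel₀ _ Real.pi_ne_zero] at h2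
  linarith

lemma norm_sum_expChar_Ico_le (a b : ℤ) (θ : ℝ) (hθ : 0 < dNI θ) :
    ‖∑ r ∈ Finset.Ico a b, expChar (r * θ)‖ ≤ (dNI θ)⁻¹ := by
  rcases le_total b a with h | h
  · rw [Finset.Ico_eq_empty (by omega)]
    simpa using hθ.le
  have tele : (expChar θ - 1) * ∑ r ∈ Finset.Ico a b, expChar (r * θ) =
      expChar (b * θ) - expChar (a * θ) := by
    induction b, h using Int.leInduction with
    | base => simp
    | succ k hk ih =>
      rw [← Finset.insert_Ico_right_eq_Ico_add_one hk, Finset.sum_insert (by simp), mul_add, ih]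
      have : ((k + 1 : ℤ) : ℝ) * θ = θ + k * θ := by push_cast; ring
      rw [this, expChar_add]
      ring
  have h1 : ‖expChar (b * θ) - expChar (a * θ)‖ ≤ 2 := by
    refine (norm_sub_le _ _).trans ?_
    rw [norm_expChar, norm_expChar]
    norm_num
  rw [← tele, norm_mul] at h1
  have h2 := four_mul_dNI_le θ
  rw [← one_div, le_div_iff₀ hθ]
  nlinarith [norm_nonneg (∑ r ∈ Finset.Ico a b, expChar (r * θ))]

lemma le_norm_sum_expChar (J : ℕ) (y : ℝ) (hy : 6 * J * dNI y ≤ 1) :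
    (J : ℝ) / 2 ≤ ‖∑ j ∈ Finset.Ico (0 : ℤ) J, expChar (j * y)‖ := by
  refine le_trans ?_ (Complex.re_le_norm _)
  rw [Complex.re_sum]
  have h : ∀ j ∈ Finset.Ico (0 : ℤ) J, (1 / 2 : ℝ) ≤ (expChar (j * y)).re := by
    intro j hj
    rw [Finset.mem_Ico] at hj
    have e1 : expChar (j * y) = expChar (j * (y - round y)) := by
      have : (j : ℝ) * y = j * (y - round y) + ((j * round y : ℤ) : ℝ) := by push_cast; ring
      rw [this, expChar_add, expChar_intCast, mul_one]
    have hj0 : (0 : ℝ) ≤ j := by exact_mod_cast hj.1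
    have hjJ : (j : ℝ) ≤ J := by exact_mod_cast hj.2.le
    rw [e1, re_expChar, ← Real.cos_abs, abs_mul (2 * Real.pi), abs_mul (j : ℝ), abs_of_nonneg hj0,
      abs_of_pos (by positivity : 0 < 2 * Real.pi)]
    have hd : |y - round y| = dNI y := rfl
    rw [hd, ← Real.cos_pi_div_three]
    have h0 := dNI_nonneg y
    have h3 : (j : ℝ) * dNI y ≤ 1 / 6 := by nlinarith
    apply Real.cos_le_cos_of_nonneg_of_le_pi
    · positivity
    · linarith [Real.pi_pos]
    · nlinarith [Real.pi_pos]
  have := Finset.sum_le_sum h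
  simp at this
  linarith

lemma exists_dyadic_scale {y : ℝ} (hy : 0 < y) (hy1 : y ≤ 1) :
    ∃ t : ℕ, (1 / 2 : ℝ) ^ (t + 1) < y ∧ y ≤ (1 / 2 : ℝ) ^ t :=
  exists_nat_pow_near_of_lt_one hy hy1 (by norm_num) (by norm_num)

/-- Points of the torus which all lie in one dyadic box and have multiplicatively separated
differences are few. -/
lemma card_le_of_separated {d : ℕ} {ι : Type*} (S : Finset ι)
    (θ : ι → Fin (d + 1) → ℝ) {κ : ℝ} (hκ : 0 < κ)
    (hsep : ∀ i ∈ S, ∀ j ∈ S, i ≠ j → κ ≤ ∏ u, dNI (θ i u - θ j u))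
    (t : Fin (d + 1) → ℕ) (ht : ∀ i ∈ S, ∀ u, dNI (θ i u) ≤ (1 / 2 : ℝ) ^ t u)
    (hbig : κ ≤ ∏ u, (1 / 2 : ℝ) ^ t u) :
    (S.card : ℝ) ≤ 2 ^ (d + 1) * 3 * (κ⁻¹ * ∏ u, (1 / 2 : ℝ) ^ t u) := by
  classical
  set P : ℝ := ∏ u, (1 / 2 : ℝ) ^ t u with hP
  set K : ℕ := ⌊κ⁻¹ * P⌋₊ + 1 with hK
  have hKP : κ⁻¹ * P < K := by
    rw [hK]; push_cast; exact Nat.lt_floor_add_one _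
  have hP1 : 1 ≤ κ⁻¹ * P := by
    rw [inv_mul_eq_div, one_le_div hκ]; exact hbig
  have hK0 : (0 : ℝ) < K := by linarith
  have hK3 : ((K + 1 : ℕ) : ℝ) ≤ 3 * (κ⁻¹ * P) := by
    have : (⌊κ⁻¹ * P⌋₊ : ℝ) ≤ κ⁻¹ * P := Nat.floor_le (by linarith)
    rw [hK]; push_cast; linarith
  let f : ι → (Fin (d + 1) → Bool) × ℕ := fun i =>
    (fun u => decide (0 ≤ θ i u - round (θ i u)), ⌊K * (dNI (θ i 0) * 2 ^ t 0)⌋₊)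
  have hf : ∀ i ∈ S, f i ∈ (Finset.univ : Finset (Fin (d + 1) → Bool)) ×ˢ Finset.range (K + 1) := by
    intro i hi
    rw [Finset.mem_product]
    refine ⟨Finset.mem_univ _, Finset.mem_range.mpr ?_⟩
    have h1 := ht i hi 0
    have h2 : dNI (θ i 0) * 2 ^ t 0 ≤ 1 := by
      refine (mul_le_mul_of_nonneg_right h1 (by positivity)).trans (le_of_eq ?_)
      rw [← mul_pow]; norm_num
    have h3 : ⌊(K : ℝ) * (dNI (θ i 0) * 2 ^ t 0)⌋₊ ≤ K := by
      apply Nat.floor_le_of_le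
      nlinarith
    exact Nat.lt_succ_of_le h3
  have hinj : Set.InjOn f S := by
    intro i hi j hj hij
    by_contra hne
    have h1 := hsep i hi j hj hne
    rw [Prod.mk.injEq] at hij
    obtain ⟨hs, hfl⟩ := hij
    have hd : ∀ u, dNI (θ i u - θ j u) ≤ |dNI (θ i u) - dNI (θ j u)| := by
      intro u
      refine (dNI_sub_le _ _).trans (le_of_eq ?_)
      have hsu := congrFun hs u
      simp only [decide_eq_decide] at hsu
      unfold dNI
      by_cases h : 0 ≤ θ i u - round (θ i u)
      · rw [abs_of_nonneg h, abs_of_nonneg (hsu.mp h)]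
      · have h' : ¬ 0 ≤ θ j u - round (θ j u) := fun h'' => h (hsu.mpr h'')
        push Not at h h'
        rw [abs_of_neg h, abs_of_neg h', ← abs_neg]
        congr 1
        ring
    have hu : ∀ u, dNI (θ i u - θ j u) ≤ (1 / 2 : ℝ) ^ t u := by
      intro u
      refine (hd u).trans ?_
      rw [abs_le]
      have a1 := ht i hi u
      have a2 := ht j hj u
      have a3 := dNI_nonneg (θ i u)
      have a4 := dNI_nonneg (θ j u)
      constructor <;> linarith
    have h0 : dNI (θ i 0 - θ j 0) ≤ (1 / 2 : ℝ) ^ t 0 / K := by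
      refine (hd 0).trans ?_
      have hlt : |(K : ℝ) * (dNI (θ i 0) * 2 ^ t 0) - K * (dNI (θ j 0) * 2 ^ t 0)| < 1 := by
        have n1 := dNI_nonneg (θ i 0)
        have n2 := dNI_nonneg (θ j 0)
        have b1 := Nat.floor_le (by positivity : 0 ≤ (K : ℝ) * (dNI (θ i 0) * 2 ^ t 0))
        have b2 := Nat.floor_le (by positivity : 0 ≤ (K : ℝ) * (dNI (θ j 0) * 2 ^ t 0))
        have b3 := Nat.lt_floor_add_one ((K : ℝ) * (dNI (θ i 0) * 2 ^ t 0))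
        have b4 := Nat.lt_floor_add_one ((K : ℝ) * (dNI (θ j 0) * 2 ^ t 0))
        rw [hfl] at b1 b3
        rw [abs_lt]
        constructor <;> linarith
      have e : (K : ℝ) * (dNI (θ i 0) * 2 ^ t 0) - K * (dNI (θ j 0) * 2 ^ t 0)
          = (K * 2 ^ t 0) * (dNI (θ i 0) - dNI (θ j 0)) := by ring
      rw [e, abs_mul, abs_of_pos (by positivity)] at hlt
      have : (1 / 2 : ℝ) ^ t 0 / K = 1 / (K * 2 ^ t 0) := by
        rw [one_div_pow]; field_simp
      rw [this, le_div_iff₀ (by positivity), mul_comm]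
      exact hlt.le
    have h2 : ∏ u, dNI (θ i u - θ j u) ≤ P / K := by
      rw [hP, Fin.prod_univ_succ, Fin.prod_univ_succ, mul_div_right_comm]
      refine mul_le_mul h0 (Finset.prod_le_prod (fun u _ => dNI_nonneg _) fun u _ => hu _)
        (Finset.prod_nonneg fun u _ => dNI_nonneg _) (by positivity)
    have h3 : P / K < κ := by
      rw [div_lt_iff₀ hK0, ← div_lt_iff₀' hκ, div_eq_inv_mul]
      exact hKP
    linarith
  have hcard := Finset.card_le_card_of_injOn f hf hinj
  rw [Finset.card_product, Finset.card_range, Finset.card_univ] at hcard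
  simp only [Fintype.card_pi, Fintype.card_bool, Finset.prod_const, Finset.card_univ,
    Fintype.card_fin] at hcard
  calc (S.card : ℝ) ≤ ((2 ^ (d + 1) * (K + 1) : ℕ) : ℝ) := by exact_mod_cast hcard
    _ = 2 ^ (d + 1) * ((K + 1 : ℕ) : ℝ) := by push_cast; ring
    _ ≤ 2 ^ (d + 1) * (3 * (κ⁻¹ * P)) := by gcongr
    _ = _ := by ring

lemma sum_prod_inv_dNI_le {d : ℕ} {ι : Type*} (S : Finset ι)
    (θ : ι → Fin (d + 1) → ℝ) {κ : ℝ} (hκ : 0 < κ)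
    (hmin : ∀ i ∈ S, κ ≤ ∏ u, dNI (θ i u))
    (hsep : ∀ i ∈ S, ∀ j ∈ S, i ≠ j → κ ≤ ∏ u, dNI (θ i u - θ j u))
    (L : ℕ) (hL : (1 / 2 : ℝ) ^ L < κ) :
    ∑ i ∈ S, ∏ u, (dNI (θ i u))⁻¹ ≤ (2 ^ (d + 1) * 3 * 2 ^ (d + 1)) * (L : ℝ) ^ (d + 1) * κ⁻¹ := by
  classical
  have hle1 : ∀ y, dNI y ≤ 1 := fun y => (dNI_le_half y).trans (by norm_num)
  have hκle : ∀ i ∈ S, ∀ u, κ ≤ dNI (θ i u) := by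
    intro i hi u
    refine (hmin i hi).trans ?_
    rw [← Finset.mul_prod_erase _ _ (Finset.mem_univ u)]
    exact mul_le_of_le_one_right (dNI_nonneg _)
      (Finset.prod_le_one (fun _ _ => dNI_nonneg _) fun _ _ => hle1 _)
  have hex : ∀ i : ι, ∀ u, ∃ t : ℕ, i ∈ S →
      (1 / 2 : ℝ) ^ (t + 1) < dNI (θ i u) ∧ dNI (θ i u) ≤ (1 / 2 : ℝ) ^ t := by
    intro i u
    by_cases hi : i ∈ S
    · obtain ⟨t, ht⟩ := exists_dyadic_scale (hκ.trans_le (hκle i hi u)) (hle1 _)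
      exact ⟨t, fun _ => ht⟩
    · exact ⟨0, fun h => absurd h hi⟩
  choose t ht using hex
  have hmaps : ∀ i ∈ S, t i ∈ Fintype.piFinset fun _ : Fin (d + 1) => Finset.range L := by
    intro i hi
    rw [Fintype.mem_piFinset]
    intro u
    rw [Finset.mem_range]
    by_contra hcon
    push Not at hcon
    have h1 : (1 / 2 : ℝ) ^ t i u ≤ (1 / 2) ^ L :=
      pow_le_pow_of_le_one (by norm_num) (by norm_num) hcon
    linarith [(ht i u hi).2, hκle i hi u]
  rw [← Finset.sum_fiberwise_of_maps_to hmaps]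
  have hfib : ∀ τ ∈ Fintype.piFinset fun _ : Fin (d + 1) => Finset.range L,
      ∑ i ∈ S with t i = τ, ∏ u, (dNI (θ i u))⁻¹ ≤ (2 ^ (d + 1) * 3 * 2 ^ (d + 1)) * κ⁻¹ := by
    intro τ _
    rcases (S.filter fun i => t i = τ).eq_empty_or_nonempty with he | ⟨i₀, hi₀⟩
    · rw [he, Finset.sum_empty]; positivity
    rw [Finset.mem_filter] at hi₀
    have hbig : κ ≤ ∏ u, (1 / 2 : ℝ) ^ τ u := by
      refine (hmin i₀ hi₀.1).trans (Finset.prod_le_prod (fun _ _ => dNI_nonneg _) fun u _ => ?_)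
      rw [← hi₀.2]
      exact (ht i₀ u hi₀.1).2
    have hcard := card_le_of_separated (S.filter fun i => t i = τ) θ hκ
      (fun i hi j hj => hsep i (Finset.mem_filter.mp hi).1 j (Finset.mem_filter.mp hj).1) τ
      (fun i hi u => by
        rw [Finset.mem_filter] at hi
        rw [← hi.2]
        exact (ht i u hi.1).2) hbig
    have hterm : ∀ i ∈ S.filter (fun i => t i = τ),
        ∏ u, (dNI (θ i u))⁻¹ ≤ 2 ^ (d + 1) * (∏ u, (1 / 2 : ℝ) ^ τ u)⁻¹ := by
      intro i hi
      rw [Finset.mem_filter] at hi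
      have : (2 : ℝ) ^ (d + 1) * (∏ u, (1 / 2 : ℝ) ^ τ u)⁻¹ =
          ∏ u, ((1 / 2 : ℝ) ^ (τ u + 1))⁻¹ := by
        simp_rw [pow_succ, mul_inv, Finset.prod_mul_distrib, Finset.prod_const, Finset.card_univ,
          Fintype.card_fin, Finset.prod_inv_distrib]
        rw [mul_comm]
        norm_num [pow_succ]
      rw [this]
      refine Finset.prod_le_prod (fun u _ => inv_nonneg.mpr (dNI_nonneg _)) fun u _ => ?_
      rw [← hi.2]
      exact inv_anti₀ (by positivity) (ht i u hi.1).1.le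
    have hP0 : 0 < ∏ u, (1 / 2 : ℝ) ^ τ u := Finset.prod_pos fun u _ => by positivity
    calc _ ≤ (S.filter fun i => t i = τ).card • (2 ^ (d + 1) * (∏ u, (1 / 2 : ℝ) ^ τ u)⁻¹) :=
          Finset.sum_le_card_nsmul _ _ _ hterm
      _ = ((S.filter fun i => t i = τ).card : ℝ) * (2 ^ (d + 1) * (∏ u, (1 / 2 : ℝ) ^ τ u)⁻¹) :=
          nsmul_eq_mul _ _
      _ ≤ (2 ^ (d + 1) * 3 * (κ⁻¹ * ∏ u, (1 / 2 : ℝ) ^ τ u)) *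
          (2 ^ (d + 1) * (∏ u, (1 / 2 : ℝ) ^ τ u)⁻¹) := by gcongr
      _ = _ := by field_simp
  refine (Finset.sum_le_card_nsmul _ _ _ hfib).trans (le_of_eq ?_)
  rw [Fintype.card_piFinset, nsmul_eq_mul]
  simp only [Finset.card_range, Finset.prod_const, Finset.card_univ, Fintype.card_fin]
  push_cast
  ring

/-- The sum bound for multiplicatively separated points, with the logarithms absorbed in a power
of the separation. -/
lemma exists_sum_prod_inv_dNI_le (d : ℕ) {ε : ℝ} (hε : 0 < ε) :
    ∃ C : ℝ, 0 < C ∧ ∀ {ι : Type} (S : Finset ι) (θ : ι → Fin (d + 1) → ℝ) (κ : ℝ), 0 < κ → κ ≤ 1 →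
      (∀ i ∈ S, κ ≤ ∏ u, dNI (θ i u)) →
      (∀ i ∈ S, ∀ j ∈ S, i ≠ j → κ ≤ ∏ u, dNI (θ i u - θ j u)) →
      ∑ i ∈ S, ∏ u, (dNI (θ i u))⁻¹ ≤ C * (κ⁻¹) ^ (1 + ε) := by
  set δ : ℝ := ε / (d + 1) with hδ
  have hδ0 : 0 < δ := by positivity
  set A : ℝ := 1 / (δ * Real.log 2) + 1 with hA
  have hlog2 : 0 < Real.log 2 := Real.log_pos (by norm_num)
  have hA0 : 0 < A := by positivity
  refine ⟨(2 ^ (d + 1) * 3 * 2 ^ (d + 1)) * A ^ (d + 1), by positivity, ?_⟩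
  intro ι S θ κ hκ hκ1 hmin hsep
  set L : ℕ := ⌊Real.log κ⁻¹ / Real.log 2⌋₊ + 1 with hL
  have hinv1 : 1 ≤ κ⁻¹ := (one_le_inv₀ hκ).mpr hκ1
  have hlog0 : 0 ≤ Real.log κ⁻¹ := Real.log_nonneg hinv1
  have h1 : (1 / 2 : ℝ) ^ L < κ := by
    have h2 : Real.log κ⁻¹ / Real.log 2 < L := by
      rw [hL]; push_cast; exact Nat.lt_floor_add_one _
    rw [div_lt_iff₀ hlog2, ← Real.log_pow] at h2
    have h3 := (Real.log_lt_log_iff (by positivity) (by positivity)).mp h2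
    rw [one_div_pow, one_div]
    exact inv_lt_of_inv_lt₀ hκ h3
  have h4 : (L : ℝ) ≤ A * (κ⁻¹) ^ δ := by
    have h5 : (⌊Real.log κ⁻¹ / Real.log 2⌋₊ : ℝ) ≤ Real.log κ⁻¹ / Real.log 2 :=
      Nat.floor_le (by positivity)
    have h6 := Real.log_le_rpow_div (inv_pos.mpr hκ).le hδ0
    have h7 : 1 ≤ (κ⁻¹) ^ δ := Real.one_le_rpow hinv1 hδ0.le
    rw [hL]
    push_cast
    calc (⌊Real.log κ⁻¹ / Real.log 2⌋₊ : ℝ) + 1 ≤ ((κ⁻¹) ^ δ / δ) / Real.log 2 + (κ⁻¹) ^ δ := by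
          gcongr
          exact h5.trans (by gcongr)
      _ = A * (κ⁻¹) ^ δ := by rw [hA]; field_simp
  refine (sum_prod_inv_dNI_le S θ hκ hmin hsep L h1).trans ?_
  have h8 : (L : ℝ) ^ (d + 1) ≤ A ^ (d + 1) * (κ⁻¹) ^ ε := by
    calc (L : ℝ) ^ (d + 1) ≤ (A * (κ⁻¹) ^ δ) ^ (d + 1) := by gcongr
      _ = _ := by
        rw [mul_pow, ← Real.rpow_mul_natCast (inv_pos.mpr hκ).le]
        congr 2
        rw [hδ]; push_cast; field_simp
  rw [Real.rpow_add (inv_pos.mpr hκ), Real.rpow_one]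
  calc _ ≤ (2 ^ (d + 1) * 3 * 2 ^ (d + 1)) * (A ^ (d + 1) * (κ⁻¹) ^ ε) * κ⁻¹ := by gcongr
    _ = _ := by ring

lemma natAbs_le_jnorm {m : ℕ} (j : Fin m → ℤ) (i : Fin m) : (j i).natAbs ≤ jnorm j :=
  Finset.le_sup (f := fun i => (j i).natAbs) (Finset.mem_univ i)

lemma one_le_jnorm {m : ℕ} {j : Fin m → ℤ} (hj : j ≠ 0) : 1 ≤ jnorm j := by
  obtain ⟨i, hi⟩ := Function.ne_iff.mp hj
  have : 1 ≤ (j i).natAbs := Int.natAbs_pos.mpr hi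
  exact this.trans (natAbs_le_jnorm j i)

/-- Below the multiplicative type, there are lower bounds for the products of distances. -/
lemma exists_le_prod_dNI_of_multType_lt {l m : ℕ} (M : Matrix (Fin l) (Fin m) ℝ) {ω : ℝ}
    (hω0 : 0 < ω) (hω : multType M < ENNReal.ofReal ω) :
    ∃ c : ℝ, 0 < c ∧ c ≤ 1 ∧ ∀ j : Fin m → ℤ, j ≠ 0 →
      c * (jnorm j : ℝ) ^ (-ω) ≤ ∏ u, dNI (∑ v, (j v : ℝ) * M u v) := by
  classical
  set f : (Fin m → ℤ) → ℝ := fun j => ∏ u, dNI (∑ v, (j v : ℝ) * M u v) with hf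
  have hfin : {j : Fin m → ℤ | j ≠ 0 ∧ f j < (jnorm j : ℝ) ^ (-ω)}.Finite := by
    by_contra hinf
    have : ENNReal.ofReal ω ≤ multType M := le_sSup ⟨ω, hω0, rfl, hinf⟩
    exact absurd hω (not_lt.mpr this)
  have hpos : ∀ j : Fin m → ℤ, j ≠ 0 → 0 < f j := by
    intro j hj
    by_contra hcon
    have h0 : f j = 0 :=
      le_antisymm (not_lt.mp hcon) (Finset.prod_nonneg fun _ _ => dNI_nonneg _)
    obtain ⟨u, _, hu⟩ := Finset.prod_eq_zero_iff.mp h0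
    have hinj : Function.Injective fun k : ℕ => ((k : ℤ) + 1) • j := by
      intro a b hab
      have := smul_left_injective ℤ hj hab
      simpa using this
    refine (Set.infinite_of_injective_forall_mem hinj fun k => ?_) hfin
    have hne : ((k : ℤ) + 1) • j ≠ 0 := smul_ne_zero (by positivity) hj
    refine ⟨hne, ?_⟩
    have hz : f (((k : ℤ) + 1) • j) = 0 := by
      refine Finset.prod_eq_zero (Finset.mem_univ u) ?_
      have e : ∑ v, (((((k : ℤ) + 1) • j) v : ℤ) : ℝ) * M u v
          = (((k : ℤ) + 1 : ℤ) : ℝ) * ∑ v, (j v : ℝ) * M u v := by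
        rw [Finset.mul_sum]
        refine Finset.sum_congr rfl fun v _ => ?_
        simp only [Pi.smul_apply, smul_eq_mul]
        push_cast
        ring
      rw [e]
      exact dNI_intCast_mul_eq_zero hu _
    rw [hz]
    have : (0 : ℝ) < jnorm (((k : ℤ) + 1) • j) := by exact_mod_cast one_le_jnorm hne
    positivity
  obtain ⟨c, hc0, hc1, hc⟩ : ∃ c : ℝ, 0 < c ∧ c ≤ 1 ∧ ∀ j ∈ hfin.toFinset, c ≤ f j := by
    rcases hfin.toFinset.eq_empty_or_nonempty with he | hne
    · exact ⟨1, one_pos, le_rfl, by simp [he]⟩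
    · obtain ⟨j₀, hj₀, hmin⟩ := Finset.exists_min_image _ f hne
      refine ⟨min 1 (f j₀), lt_min one_pos (hpos _ ?_), min_le_left _ _, fun j hj =>
        (min_le_right _ _).trans (hmin j hj)⟩
      exact (hfin.mem_toFinset.mp hj₀).1
  refine ⟨c, hc0, hc1, fun j hj => ?_⟩
  have hn : (1 : ℝ) ≤ jnorm j := by exact_mod_cast one_le_jnorm hj
  by_cases hmem : f j < (jnorm j : ℝ) ^ (-ω)
  · have h1 := hc j (hfin.mem_toFinset.mpr ⟨hj, hmem⟩)
    have h2 : (jnorm j : ℝ) ^ (-ω) ≤ 1 := Real.rpow_le_one_of_one_le_of_nonpos hn (by linarith)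
    nlinarith
  · have h2 : (0 : ℝ) ≤ (jnorm j : ℝ) ^ (-ω) := by positivity
    push Not at hmem
    nlinarith

/-- Duality between counting solutions of `‖r M‖ ≤ 1/(6J)` and exponential sums. -/
lemma card_mul_pow_le_sum {D m : ℕ} (M : Matrix (Fin D) (Fin m) ℝ) (J : ℕ) (a b : ℤ) :
    (((Fintype.piFinset fun _ : Fin D => Finset.Ico a b).filter
      fun r => ∀ v, 6 * J * dNI (∑ u, (r u : ℝ) * M u v) ≤ 1).card : ℝ) * ((J : ℝ) / 2) ^ (2 * m) ≤
    ∑ j' ∈ Fintype.piFinset fun _ : Fin m => Finset.Ico (0 : ℤ) J,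
      ∑ j ∈ Fintype.piFinset fun _ : Fin m => Finset.Ico (0 : ℤ) J,
        ∏ u, ‖∑ r ∈ Finset.Ico a b, expChar (r * ∑ v, ((j - j') v : ℝ) * M u v)‖ := by
  classical
  set B := Fintype.piFinset fun _ : Fin D => Finset.Ico a b with hB
  set S := Fintype.piFinset fun _ : Fin m => Finset.Ico (0 : ℤ) J with hS
  set y : (Fin D → ℤ) → Fin m → ℝ := fun r v => ∑ u, (r u : ℝ) * M u v with hy
  set g : (Fin D → ℤ) → ℂ := fun r => ∏ v, ∑ j ∈ Finset.Ico (0 : ℤ) J, expChar (j * y r v) with hg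
  have hg1 : ∀ r, g r = ∑ j ∈ S, expChar (∑ v, (j v : ℝ) * y r v) := by
    intro r
    simp only [hg, Finset.prod_univ_sum, expChar_sum, hS]
  have hlow : ∀ r ∈ B.filter (fun r => ∀ v, 6 * J * dNI (y r v) ≤ 1),
      ((J : ℝ) / 2) ^ (2 * m) ≤ ‖g r‖ ^ 2 := by
    intro r hr
    rw [Finset.mem_filter] at hr
    rw [mul_comm, pow_mul]
    refine pow_le_pow_left₀ (by positivity) ?_ 2
    rw [hg, norm_prod]
    calc ((J : ℝ) / 2) ^ m = ∏ _v : Fin m, (J : ℝ) / 2 := by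
          rw [Finset.prod_const, Finset.card_univ, Fintype.card_fin]
      _ ≤ _ := Finset.prod_le_prod (fun _ _ => by positivity)
          fun v _ => le_norm_sum_expChar J _ (hr.2 v)
  have hsum : ((∑ r ∈ B, ‖g r‖ ^ 2 : ℝ) : ℂ) = ∑ j' ∈ S, ∑ j ∈ S,
      ∏ u, ∑ r ∈ Finset.Ico a b, expChar (r * ∑ v, ((j - j') v : ℝ) * M u v) := by
    push_cast
    have h1 : ∀ r, ((‖g r‖ : ℂ)) ^ 2 =
        ∑ j' ∈ S, ∑ j ∈ S, ∏ u, expChar (r u * ∑ v, ((j - j') v : ℝ) * M u v) := by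
      intro r
      rw [← Complex.mul_conj', hg1, map_sum, Finset.sum_mul_sum, Finset.sum_comm]
      refine Finset.sum_congr rfl fun j' _ => Finset.sum_congr rfl fun j _ => ?_
      rw [conj_expChar, ← expChar_add, ← expChar_sum]
      congr 1
      rw [← Finset.sum_neg_distrib, ← Finset.sum_add_distrib]
      simp only [hy, Finset.mul_sum]
      simp only [← Finset.sum_neg_distrib, ← Finset.sum_add_distrib]
      rw [Finset.sum_comm]
      refine Finset.sum_congr rfl fun u _ => Finset.sum_congr rfl fun v _ => ?_
      rw [Pi.sub_apply]
      push_cast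
      ring
    simp_rw [h1]
    rw [Finset.sum_comm]
    refine Finset.sum_congr rfl fun j' _ => ?_
    rw [Finset.sum_comm]
    refine Finset.sum_congr rfl fun j _ => ?_
    rw [Finset.prod_univ_sum]
  calc _ = (B.filter (fun r => ∀ v, 6 * J * dNI (y r v) ≤ 1)).card • ((J : ℝ) / 2) ^ (2 * m) := by
        rw [nsmul_eq_mul]
    _ ≤ ∑ r ∈ B.filter (fun r => ∀ v, 6 * J * dNI (y r v) ≤ 1), ‖g r‖ ^ 2 :=
        Finset.card_nsmul_le_sum _ _ _ hlow
    _ ≤ ∑ r ∈ B, ‖g r‖ ^ 2 :=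
        Finset.sum_le_sum_of_subset_of_nonneg (Finset.filter_subset _ _) fun _ _ _ => by positivity
    _ = ‖((∑ r ∈ B, ‖g r‖ ^ 2 : ℝ) : ℂ)‖ := by
        rw [Complex.norm_real, Real.norm_of_nonneg]
        exact Finset.sum_nonneg fun _ _ => by positivity
    _ ≤ _ := by
        rw [hsum]
        refine (norm_sum_le _ _).trans (Finset.sum_le_sum fun j' _ => ?_)
        refine (norm_sum_le _ _).trans (Finset.sum_le_sum fun j _ => ?_)
        rw [norm_prod]

lemma jnorm_sub_le {m J : ℕ} {j j' : Fin m → ℤ}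
    (hj : j ∈ Fintype.piFinset fun _ : Fin m => Finset.Ico (0 : ℤ) J)
    (hj' : j' ∈ Fintype.piFinset fun _ : Fin m => Finset.Ico (0 : ℤ) J) :
    jnorm (j - j') ≤ J := by
  refine Finset.sup_le fun i _ => ?_
  have h1 := Finset.mem_Ico.mp (Fintype.mem_piFinset.mp hj i)
  have h2 := Finset.mem_Ico.mp (Fintype.mem_piFinset.mp hj' i)
  rw [Pi.sub_apply]
  omega

/-- Upper bound for the number of integer points `r` of a cube with `‖r M‖ ≤ 1/(6J)`, in terms of
a lower bound for the products of distances. -/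
lemma exists_card_mul_pow_le {d m : ℕ} (M : Matrix (Fin (d + 1)) (Fin m) ℝ) {ω ε c : ℝ}
    (hω : 0 < ω) (hε : 0 < ε) (hc : 0 < c) (hc1 : c ≤ 1)
    (hM : ∀ j : Fin m → ℤ, j ≠ 0 →
      c * (jnorm j : ℝ) ^ (-ω) ≤ ∏ u, dNI (∑ v, (j v : ℝ) * M u v)) :
    ∃ C : ℝ, 0 < C ∧ ∀ J : ℕ, 1 ≤ J → ∀ N : ℕ,
      (((Fintype.piFinset fun _ : Fin (d + 1) => Finset.Ico (-(N : ℤ)) N).filter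
        fun r => ∀ v, 6 * J * dNI (∑ u, (r u : ℝ) * M u v) ≤ 1).card : ℝ) * (J : ℝ) ^ m ≤
      C * ((N : ℝ) ^ (d + 1) + (J : ℝ) ^ (ω * (1 + ε))) := by
  classical
  obtain ⟨C₀, hC₀, hsum⟩ := exists_sum_prod_inv_dNI_le d hε
  set C₁ : ℝ := 2 ^ (d + 1) + C₀ * (c⁻¹) ^ (1 + ε) with hC₁
  have hC₁0 : 0 < C₁ := by positivity
  refine ⟨2 ^ (2 * m) * C₁, by positivity, ?_⟩
  intro J hJ N
  have hJ0 : (0 : ℝ) < J := by exact_mod_cast hJ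
  have hJ1 : (1 : ℝ) ≤ J := by exact_mod_cast hJ
  set S := Fintype.piFinset fun _ : Fin m => Finset.Ico (0 : ℤ) J with hS
  set κ : ℝ := c * (J : ℝ) ^ (-ω) with hκ
  have hκ0 : 0 < κ := by positivity
  have hκ1 : κ ≤ 1 := by
    have : (J : ℝ) ^ (-ω) ≤ 1 := Real.rpow_le_one_of_one_le_of_nonpos hJ1 (by linarith)
    have h0 : (0 : ℝ) ≤ (J : ℝ) ^ (-ω) := by positivity
    nlinarith
  have hκle : ∀ j ∈ S, ∀ j' ∈ S, j ≠ j' →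
      κ ≤ ∏ u, dNI (∑ v, ((j - j') v : ℝ) * M u v) := by
    intro j hj j' hj' hne
    refine le_trans ?_ (hM (j - j') (sub_ne_zero.mpr hne))
    have h1 : (0 : ℝ) < jnorm (j - j') := by exact_mod_cast one_le_jnorm (sub_ne_zero.mpr hne)
    have h2 : (jnorm (j - j') : ℝ) ≤ J := by exact_mod_cast jnorm_sub_le hj hj'
    exact mul_le_mul_of_nonneg_left
      (Real.rpow_le_rpow_of_nonpos h1 h2 (by linarith)) hc.le
  have hinner : ∀ j' ∈ S, ∑ j ∈ S, ∏ u,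
      ‖∑ r ∈ Finset.Ico (-(N : ℤ)) N, expChar (r * ∑ v, ((j - j') v : ℝ) * M u v)‖ ≤
      C₁ * ((N : ℝ) ^ (d + 1) + (J : ℝ) ^ (ω * (1 + ε))) := by
    intro j' hj'
    rw [← Finset.add_sum_erase _ _ hj']
    have hdiag : ∏ u, ‖∑ r ∈ Finset.Ico (-(N : ℤ)) N,
        expChar (r * ∑ v, ((j' - j') v : ℝ) * M u v)‖ ≤ 2 ^ (d + 1) * (N : ℝ) ^ (d + 1) := by
      calc _ ≤ ∏ _u : Fin (d + 1), (2 * (N : ℝ)) := by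
            refine Finset.prod_le_prod (fun _ _ => norm_nonneg _) fun u _ => ?_
            refine (norm_sum_le _ _).trans ?_
            simp only [norm_expChar, Finset.sum_const, Int.card_Ico, nsmul_eq_mul, mul_one]
            have : ((N : ℤ) - -(N : ℤ)).toNat = 2 * N := by omega
            rw [this]
            push_cast
            rfl
        _ = _ := by
            rw [Finset.prod_const, Finset.card_univ, Fintype.card_fin, mul_pow]
    have hoff : ∑ j ∈ S.erase j', ∏ u, ‖∑ r ∈ Finset.Ico (-(N : ℤ)) N,
        expChar (r * ∑ v, ((j - j') v : ℝ) * M u v)‖ ≤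
        C₀ * (c⁻¹) ^ (1 + ε) * (J : ℝ) ^ (ω * (1 + ε)) := by
      have h1 := hsum (S.erase j') (fun j u => ∑ v, ((j - j') v : ℝ) * M u v) κ hκ0 hκ1
        (fun j hj => hκle j (Finset.mem_of_mem_erase hj) j' hj' (Finset.ne_of_mem_erase hj))
        (fun i hi j hj hij => by
          have h2 := hκle i (Finset.mem_of_mem_erase hi) j (Finset.mem_of_mem_erase hj) hij
          refine h2.trans (le_of_eq (Finset.prod_congr rfl fun u _ => ?_))
          rw [← Finset.sum_sub_distrib]
          congr 1
          refine Finset.sum_congr rfl fun v _ => ?_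
          simp only [Pi.sub_apply]
          push_cast
          ring)
      have h3 : (κ⁻¹) ^ (1 + ε) = (c⁻¹) ^ (1 + ε) * (J : ℝ) ^ (ω * (1 + ε)) := by
        rw [hκ, mul_inv, Real.rpow_neg hJ0.le, inv_inv, Real.mul_rpow (by positivity)
          (by positivity), ← Real.rpow_mul hJ0.le]
      rw [h3, ← mul_assoc] at h1
      refine le_trans (Finset.sum_le_sum fun j hj => ?_) h1
      refine Finset.prod_le_prod (fun _ _ => norm_nonneg _) fun u _ => ?_
      refine norm_sum_expChar_Ico_le _ _ _ ?_
      have h4 := hκ0.trans_le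
        (hκle j (Finset.mem_of_mem_erase hj) j' hj' (Finset.ne_of_mem_erase hj))
      refine lt_of_le_of_ne (dNI_nonneg _) fun h0 => ?_
      rw [Finset.prod_eq_zero (Finset.mem_univ u) h0.symm] at h4
      exact lt_irrefl _ h4
    have p1 : (0 : ℝ) ≤ (N : ℝ) ^ (d + 1) := by positivity
    have p2 : (0 : ℝ) ≤ (J : ℝ) ^ (ω * (1 + ε)) := by positivity
    have p3 : (0 : ℝ) ≤ C₀ * (c⁻¹) ^ (1 + ε) := by positivity
    have p4 : (0 : ℝ) ≤ 2 ^ (d + 1) := by positivity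
    have p5 := mul_nonneg p3 p1
    have p6 := mul_nonneg p4 p2
    rw [hC₁]
    linarith
  have h := (card_mul_pow_le_sum M J (-(N : ℤ)) N).trans (Finset.sum_le_card_nsmul _ _ _ hinner)
  have hcardS : S.card = J ^ m := by
    rw [hS, Fintype.card_piFinset]
    simp
  rw [hcardS, nsmul_eq_mul, div_pow, ← mul_div_assoc, div_le_iff₀ (by positivity)] at h
  push_cast at h
  have hJm : (0 : ℝ) < (J : ℝ) ^ m := by positivity
  refine le_of_mul_le_mul_right ?_ hJm
  calc _ = (((Fintype.piFinset fun _ : Fin (d + 1) => Finset.Ico (-(N : ℤ)) N).filter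
        fun r => ∀ v, 6 * J * dNI (∑ u, (r u : ℝ) * M u v) ≤ 1).card : ℝ) * (J : ℝ) ^ (2 * m) := by
        ring
    _ ≤ _ := h
    _ = _ := by ring

/-- Real-parameter form of the counting bound: the expected order of magnitude is an upper bound
as soon as the cube is large enough in terms of the target size. -/
lemma exists_card_le {d m : ℕ} (M : Matrix (Fin (d + 1)) (Fin m) ℝ) {ω' : ℝ}
    (hω : multType M < ENNReal.ofReal ω') :
    ∃ ω : ℝ, 0 < ω ∧ ω < ω' ∧ ∃ C : ℝ, 0 < C ∧ ∀ δ : ℝ, 0 < δ → ∀ N : ℕ,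
      (δ⁻¹) ^ ω ≤ (N : ℝ) ^ (d + 1) →
      (((Fintype.piFinset fun _ : Fin (d + 1) => Finset.Ico (-(N : ℤ)) N).filter
        fun r => ∀ v, dNI (∑ u, (r u : ℝ) * M u v) ≤ δ).card : ℝ) ≤
      C * δ ^ m * (N : ℝ) ^ (d + 1) := by
  classical
  obtain ⟨w, hw1, hw2⟩ := exists_between hω
  have hwtop : w ≠ ⊤ := ne_top_of_lt hw2
  have hw0 : 0 < w.toReal := ENNReal.toReal_pos (ne_bot_of_gt hw1) hwtop
  have hww : w.toReal < ω' := by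
    rw [← ENNReal.ofReal_toReal hwtop] at hw2
    exact (ENNReal.ofReal_lt_ofReal_iff_of_nonneg hw0.le).mp hw2
  rw [← ENNReal.ofReal_toReal hwtop] at hw1
  set ω₀ := w.toReal with hω₀
  obtain ⟨ω, hω1, hω2⟩ := exists_between hww
  set ε := ω / ω₀ - 1 with hε
  have hε0 : 0 < ε := by
    rw [hε, sub_pos, one_lt_div hw0]; exact hω1
  have hεω : ω₀ * (1 + ε) = ω := by
    rw [hε]; field_simp; ring
  obtain ⟨c, hc0, hc1, hM⟩ := exists_le_prod_dNI_of_multType_lt M hw0 hw1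
  obtain ⟨C, hC, hcount⟩ := exists_card_mul_pow_le M hw0 hε0 hc0 hc1 hM
  rw [hεω] at hcount
  have hω0 : 0 < ω := hw0.trans hω1
  refine ⟨ω, hω0, hω2, C * 2 * 12 ^ m + 2 ^ (d + 1) * 12 ^ m, by positivity, ?_⟩
  intro δ hδ N hN
  have hNn : (0 : ℝ) ≤ (N : ℝ) ^ (d + 1) := by positivity
  rcases le_or_gt (6 * δ) 1 with h6 | h6
  · set J : ℕ := ⌊(6 * δ)⁻¹⌋₊ with hJ
    have hinv : 1 ≤ (6 * δ)⁻¹ := (one_le_inv₀ (by positivity)).mpr h6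
    have hJ1 : 1 ≤ J := Nat.le_floor (by exact_mod_cast hinv)
    have hJ1' : (1 : ℝ) ≤ J := by exact_mod_cast hJ1
    have hJle : (J : ℝ) ≤ (6 * δ)⁻¹ := Nat.floor_le (by positivity)
    have hJδ : 6 * J * δ ≤ 1 := by
      have := mul_le_mul_of_nonneg_right hJle (by positivity : 0 ≤ 6 * δ)
      rw [inv_mul_cancel₀ (by positivity)] at this
      linarith
    have hJδ' : 1 ≤ 12 * δ * J := by
      have h1 : (6 * δ)⁻¹ < J + 1 := Nat.lt_floor_add_one _
      rw [inv_lt_iff_one_lt_mul₀ (by positivity)] at h1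
      nlinarith
    have h := hcount J hJ1 N
    have hJω : (J : ℝ) ^ ω ≤ (N : ℝ) ^ (d + 1) := by
      refine le_trans (Real.rpow_le_rpow (by positivity) (hJle.trans ?_) hω0.le) hN
      exact inv_anti₀ hδ (by linarith)
    have hsub : (((Fintype.piFinset fun _ : Fin (d + 1) => Finset.Ico (-(N : ℤ)) N).filter
        fun r => ∀ v, dNI (∑ u, (r u : ℝ) * M u v) ≤ δ).card : ℝ) ≤
        (((Fintype.piFinset fun _ : Fin (d + 1) => Finset.Ico (-(N : ℤ)) N).filter
        fun r => ∀ v, 6 * J * dNI (∑ u, (r u : ℝ) * M u v) ≤ 1).card : ℝ) := by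
      refine Nat.cast_le.mpr (Finset.card_le_card (Finset.monotone_filter_right _ ?_))
      intro r _ hr v
      exact (mul_le_mul_of_nonneg_left (hr v) (by positivity)).trans hJδ
    refine hsub.trans ?_
    set X := (((Fintype.piFinset fun _ : Fin (d + 1) => Finset.Ico (-(N : ℤ)) N).filter
        fun r => ∀ v, 6 * J * dNI (∑ u, (r u : ℝ) * M u v) ≤ 1).card : ℝ) with hX
    have hX0 : 0 ≤ X := Nat.cast_nonneg _
    calc X = X * 1 := (mul_one _).symm
      _ ≤ X * (12 * δ * J) ^ m := by gcongr; exact one_le_pow₀ hJδ'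
      _ = (X * (J : ℝ) ^ m) * (12 * δ) ^ m := by ring
      _ ≤ (C * ((N : ℝ) ^ (d + 1) + (N : ℝ) ^ (d + 1))) * (12 * δ) ^ m := by
          exact mul_le_mul_of_nonneg_right (h.trans (by gcongr)) (by positivity)
      _ = (C * 2 * 12 ^ m) * δ ^ m * (N : ℝ) ^ (d + 1) := by ring
      _ ≤ _ := by
          gcongr
          exact le_add_of_nonneg_right (by positivity)
  · have hle := Finset.card_filter_le (Fintype.piFinset fun _ : Fin (d + 1) =>
      Finset.Ico (-(N : ℤ)) N) (fun r => ∀ v, dNI (∑ u, (r u : ℝ) * M u v) ≤ δ)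
    have hcard : (Fintype.piFinset fun _ : Fin (d + 1) => Finset.Ico (-(N : ℤ)) N).card =
        (2 * N) ^ (d + 1) := by
      have : ((N : ℤ) - -(N : ℤ)).toNat = 2 * N := by omega
      rw [Fintype.card_piFinset]
      simp only [Int.card_Ico, this, Finset.prod_const, Finset.card_univ, Fintype.card_fin]
    rw [hcard] at hle
    calc _ ≤ (((2 * N) ^ (d + 1) : ℕ) : ℝ) := Nat.cast_le.mpr hle
      _ = 2 ^ (d + 1) * 1 * (N : ℝ) ^ (d + 1) := by push_cast; ring
      _ ≤ 2 ^ (d + 1) * (12 * δ) ^ m * (N : ℝ) ^ (d + 1) := by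
          gcongr
          exact one_le_pow₀ (by linarith)
      _ = (2 ^ (d + 1) * 12 ^ m) * δ ^ m * (N : ℝ) ^ (d + 1) := by ring
      _ ≤ _ := by
          gcongr
          exact le_add_of_nonneg_left (by positivity)

open Filter Topology in
/-- Hausdorff–Cantelli lemma. -/
lemma hausdorffMeasure_eq_zero_of_infinite_mem {X ι : Type*} [EMetricSpace X] [MeasurableSpace X]
    [BorelSpace X] [Countable ι] {s : ℝ} (hs : 0 < s) (V : ι → Set X)
    (hV : ∑' i, Metric.ediam (V i) ^ s ≠ ∞) {E : Set X} (hE : ∀ x ∈ E, {i | x ∈ V i}.Infinite) :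
    μH[s] E = 0 := by
  have htail := ENNReal.tendsto_tsum_compl_atTop_zero hV
  have hr : Tendsto (fun F : Finset ι => (∑' i : {i // i ∉ F}, Metric.ediam (V i) ^ s) ^ s⁻¹)
      atTop (𝓝 0) := by
    have h1 := (ENNReal.continuous_rpow_const (y := s⁻¹)).tendsto 0
    rw [ENNReal.zero_rpow_of_pos (by positivity)] at h1
    exact h1.comp htail
  have h := Measure.hausdorffMeasure_le_liminf_tsum s E
    (fun F : Finset ι => (∑' i : {i // i ∉ F}, Metric.ediam (V i) ^ s) ^ s⁻¹) hr
    (fun F (i : {i // i ∉ F}) => V i)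
    (Eventually.of_forall fun F i => by
      rw [ENNReal.le_rpow_inv_iff hs]
      exact ENNReal.le_tsum (f := fun i : {i // i ∉ F} => Metric.ediam (V i) ^ s) i)
    (Eventually.of_forall fun F x hx => by
      obtain ⟨i, hi, hiF⟩ := (hE x hx).exists_notMem_finset F
      exact Set.mem_iUnion.mpr ⟨⟨i, hiF⟩, hi⟩)
  rw [htail.liminf_eq] at h
  exact le_antisymm h bot_le

/-- Cauchy condensation for a monotone function times a power. -/
lemma summable_condensed_rpow {ψ : ℕ → ℝ} (hψ : ∀ q, 0 ≤ ψ q) (hmono : Antitone ψ) {p a : ℝ}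
    (hp : 0 ≤ p) (ha : 0 ≤ a) (hsum : Summable fun q : ℕ => ψ q ^ p * (q : ℝ) ^ a) :
    Summable fun k : ℕ => ψ (2 ^ k) ^ p * ((2 : ℝ) ^ k) ^ (a + 1) := by
  have hinj : Function.Injective fun x : Σ k : ℕ, Fin (2 ^ k) => 2 ^ x.1 + (x.2 : ℕ) := by
    rintro ⟨k, i⟩ ⟨l, j⟩ h
    simp only at h
    have hlog : ∀ (k : ℕ) (i : Fin (2 ^ k)), Nat.log 2 (2 ^ k + i) = k := by
      intro k i
      rw [Nat.log_eq_iff (Or.inr ⟨by norm_num, by positivity⟩)]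
      have := i.2
      constructor
      · omega
      · rw [pow_succ]; omega
    have hkl : k = l := by rw [← hlog k i, h, hlog l j]
    subst hkl
    simp only [Sigma.mk.injEq, heq_eq_eq, true_and]
    ext
    omega
  have h1 := (hsum.comp_injective hinj).sigma
  simp only [Function.comp_def, tsum_fintype] at h1
  rw [← summable_nat_add_iff 1]
  refine Summable.of_nonneg_of_le
    (fun k => mul_nonneg (Real.rpow_nonneg (hψ _) _) (by positivity)) (fun k => ?_)
    (h1.mul_left ((2 : ℝ) ^ (a + 1)))
  have h2 : ∀ i : Fin (2 ^ k), ψ (2 ^ (k + 1)) ^ p * ((2 : ℝ) ^ k) ^ a ≤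
      ψ (2 ^ k + i) ^ p * ((2 ^ k + i : ℕ) : ℝ) ^ a := by
    intro i
    have hi := i.2
    refine mul_le_mul (Real.rpow_le_rpow (hψ _) (hmono ?_) hp)
      (Real.rpow_le_rpow (by positivity) ?_ ha) (by positivity) (Real.rpow_nonneg (hψ _) _)
    · rw [pow_succ]; omega
    · push_cast
      linarith [(Nat.cast_nonneg (i : ℕ) : (0 : ℝ) ≤ (i : ℕ))]
  have h3 := Finset.card_nsmul_le_sum Finset.univ _ _ fun i _ => h2 i
  rw [Finset.card_univ, Fintype.card_fin, nsmul_eq_mul] at h3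
  refine le_trans (le_of_eq ?_) (mul_le_mul_of_nonneg_left h3 (by positivity))
  push_cast
  rw [pow_succ (2 : ℝ) k, Real.mul_rpow (by positivity) (by norm_num),
    Real.rpow_add (by positivity : (0 : ℝ) < 2 ^ k), Real.rpow_one]
  ring

lemma add_rpow_le_two_rpow_mul {x y p : ℝ} (hx : 0 ≤ x) (hy : 0 ≤ y) (hp : 0 ≤ p) :
    (x + y) ^ p ≤ 2 ^ p * (x ^ p + y ^ p) := by
  have hx' : 0 ≤ x ^ p := Real.rpow_nonneg hx p
  have hy' : 0 ≤ y ^ p := Real.rpow_nonneg hy p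
  have h2 : (0 : ℝ) ≤ 2 ^ p := by positivity
  rcases le_total x y with h | h
  · calc (x + y) ^ p ≤ (2 * y) ^ p := Real.rpow_le_rpow (by positivity) (by linarith) hp
      _ = 2 ^ p * y ^ p := Real.mul_rpow (by norm_num) hy
      _ ≤ _ := mul_le_mul_of_nonneg_left (by linarith) h2
  · calc (x + y) ^ p ≤ (2 * x) ^ p := Real.rpow_le_rpow (by positivity) (by linarith) hp
      _ = 2 ^ p * x ^ p := Real.mul_rpow (by norm_num) hx
      _ ≤ _ := mul_le_mul_of_nonneg_left (by linarith) h2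

lemma summable_two_pow_rpow_neg {b : ℝ} (hb : 0 < b) :
    Summable fun k : ℕ => ((2 : ℝ) ^ k) ^ (-b) := by
  have h : ∀ k : ℕ, ((2 : ℝ) ^ k) ^ (-b) = ((2 : ℝ) ^ (-b)) ^ k := by
    intro k
    rw [← Real.rpow_natCast_mul (by norm_num), mul_comm, Real.rpow_mul_natCast (by norm_num)]
  simp_rw [h]
  exact summable_geometric_of_lt_one (by positivity)
    (Real.rpow_lt_one_of_one_lt_of_neg (by norm_num) (by linarith))

/-- Replacing `ψ` by `ψ + q^{-η}` with `η` large does not affect convergence. -/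
lemma summable_condensed_add_rpow {ψ : ℕ → ℝ} (hψ : ∀ q, 0 ≤ ψ q) {p b η : ℝ} (hp : 0 ≤ p)
    (hη : b < η * p) (hsum : Summable fun k : ℕ => ψ (2 ^ k) ^ p * ((2 : ℝ) ^ k) ^ b) :
    Summable fun k : ℕ => (ψ (2 ^ k) + ((2 : ℝ) ^ k) ^ (-η)) ^ p * ((2 : ℝ) ^ k) ^ b := by
  have h1 := summable_two_pow_rpow_neg (sub_pos.mpr hη)
  refine Summable.of_nonneg_of_le (fun k => ?_) (fun k => ?_) ((hsum.add h1).mul_left (2 ^ p))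
  · have := hψ (2 ^ k)
    positivity
  · have h2 := add_rpow_le_two_rpow_mul (hψ (2 ^ k))
      (by positivity : 0 ≤ ((2 : ℝ) ^ k) ^ (-η)) hp
    have h3 : ((2 : ℝ) ^ k) ^ (-(η * p - b)) =
        (((2 : ℝ) ^ k) ^ (-η)) ^ p * ((2 : ℝ) ^ k) ^ b := by
      rw [← Real.rpow_mul (by positivity), ← Real.rpow_add (by positivity)]
      congr 1
      ring
    rw [h3]
    calc _ ≤ (2 ^ p * (ψ (2 ^ k) ^ p + (((2 : ℝ) ^ k) ^ (-η)) ^ p)) * ((2 : ℝ) ^ k) ^ b := by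
          gcongr
      _ = _ := by ring

/-- The points of the affine subspace parametrised by `M` whose first coordinates are bounded by
`R` and which are close to the rational point with denominator `r 0` and numerators `r i`, where
`2 ^ k ≤ r 0 < 2 ^ (k + 1)` and `r` is taken from a prescribed finite set. -/
def nearRational {d m : ℕ} (M : Matrix (Fin (d + 1)) (Fin m) ℝ) (ψ : ℕ → ℝ)
    (T : ℕ → Finset (Fin (d + 1) → ℤ)) (i : ℕ × (Fin (d + 1) → ℤ)) :
    Set ((Fin d → ℝ) × (Fin m → ℝ)) :=
  {p | (∃ x : Fin d → ℝ,
      p = (x, fun v => ∑ u, (Fin.cons (1 : ℝ) x : Fin (d + 1) → ℝ) u * M u v)) ∧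
    i.2 ∈ T i.1 ∧ (2 : ℝ) ^ i.1 ≤ i.2 0 ∧
    ∀ u : Fin d, |(i.2 0 : ℝ) * p.1 u - i.2 u.succ| ≤ ψ (2 ^ i.1)}

lemma abs_sum_mul_le {l m : ℕ} (M : Matrix (Fin l) (Fin m) ℝ) (z : Fin l → ℝ) {B : ℝ}
    (hz : ∀ u, |z u| ≤ B) (hB : 0 ≤ B) (v : Fin m) :
    |∑ u, z u * M u v| ≤ (1 + ∑ v, ∑ u, |M u v|) * B := by
  have h1 : ∑ u, |M u v| ≤ ∑ v, ∑ u, |M u v| :=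
    Finset.single_le_sum (f := fun v => ∑ u, |M u v|)
      (fun v _ => Finset.sum_nonneg fun u _ => abs_nonneg _) (Finset.mem_univ v)
  calc |∑ u, z u * M u v| ≤ ∑ u, |z u * M u v| := Finset.abs_sum_le_sum_abs _ _
    _ ≤ ∑ u, B * |M u v| := Finset.sum_le_sum fun u _ => by
        rw [abs_mul]; exact mul_le_mul_of_nonneg_right (hz u) (abs_nonneg _)
    _ = (∑ u, |M u v|) * B := by rw [← Finset.mul_sum, mul_comm]
    _ ≤ _ := by gcongr; linarith

lemma ediam_nearRational_le {d m : ℕ} (M : Matrix (Fin (d + 1)) (Fin m) ℝ) {ψ : ℕ → ℝ}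
    (hψ : ∀ q, 0 ≤ ψ q) (T : ℕ → Finset (Fin (d + 1) → ℤ)) (i : ℕ × (Fin (d + 1) → ℤ)) :
    Metric.ediam (nearRational M ψ T i) ≤
      ENNReal.ofReal ((1 + ∑ v, ∑ u, |M u v|) * (2 * ψ (2 ^ i.1) / 2 ^ i.1)) := by
  set C₁ := 1 + ∑ v, ∑ u, |M u v| with hC₁
  have hC₁1 : 1 ≤ C₁ := by
    have : 0 ≤ ∑ v, ∑ u, |M u v| :=
      Finset.sum_nonneg fun v _ => Finset.sum_nonneg fun u _ => abs_nonneg _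
    linarith
  have hB : 0 ≤ 2 * ψ (2 ^ i.1) / 2 ^ i.1 := by have := hψ (2 ^ i.1); positivity
  refine Metric.ediam_le fun p hp p' hp' => ?_
  obtain ⟨⟨x, rfl⟩, -, h0, hx⟩ := hp
  obtain ⟨⟨x', rfl⟩, -, -, hx'⟩ := hp'
  rw [edist_dist]
  refine ENNReal.ofReal_le_ofReal ?_
  have hr0 : (0 : ℝ) < i.2 0 := lt_of_lt_of_le (by positivity) h0
  have hxx : ∀ u, |x u - x' u| ≤ 2 * ψ (2 ^ i.1) / 2 ^ i.1 := by
    intro u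
    have h1 := abs_le.mp (hx u)
    have h2 := abs_le.mp (hx' u)
    dsimp only at h1 h2
    have h3 : |(i.2 0 : ℝ) * (x u - x' u)| ≤ 2 * ψ (2 ^ i.1) := by
      rw [abs_le, mul_sub]; constructor <;> linarith
    rw [abs_mul, abs_of_pos hr0] at h3
    rw [le_div_iff₀ (by positivity), mul_comm]
    exact (mul_le_mul_of_nonneg_right h0 (abs_nonneg _)).trans h3
  rw [Prod.dist_eq]
  refine max_le ?_ ?_
  · rw [dist_pi_le_iff (by positivity)]
    intro u
    rw [Real.dist_eq]
    exact (hxx u).trans (le_mul_of_one_le_left hB hC₁1)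
  · rw [dist_pi_le_iff (by positivity)]
    intro v
    rw [Real.dist_eq, ← Finset.sum_sub_distrib]
    simp_rw [← sub_mul]
    refine abs_sum_mul_le M _ (fun u => ?_) hB v
    refine Fin.cases ?_ (fun u => ?_) u
    · simpa using hB
    · simpa using hxx u

/-- Every good approximation of a bounded point of the affine subspace comes from an integer point
`r` in a cube for which `r M` is close to an integer point. -/
lemma exists_mem_nearRational {d m : ℕ} (M : Matrix (Fin (d + 1)) (Fin m) ℝ) {ψ : ℕ → ℝ}
    (hψ : ∀ q, 0 ≤ ψ q) (hmono : Antitone ψ) (R : ℕ) (T : ℕ → Finset (Fin (d + 1) → ℤ))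
    (hT : ∀ k, ∀ r : Fin (d + 1) → ℤ,
      (∀ u, -((2 ^ (k + 1) * (R + 1) : ℕ) : ℤ) ≤ r u ∧ r u < (2 ^ (k + 1) * (R + 1) : ℕ)) →
      (∀ v, dNI (∑ u, (r u : ℝ) * M u v) ≤ (1 + ∑ v, ∑ u, |M u v|) * ψ (2 ^ k)) → r ∈ T k)
    (x : Fin d → ℝ) (hxR : ∀ u, |x u| ≤ R) (q : ℕ) (hq : 0 < q)
    (h1 : ∀ u, dNI ((q : ℝ) * x u) < ψ q)
    (h2 : ∀ v, dNI ((q : ℝ) * ∑ u, (Fin.cons (1 : ℝ) x : Fin (d + 1) → ℝ) u * M u v) < ψ q) :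
    (x, fun v => ∑ u, (Fin.cons (1 : ℝ) x : Fin (d + 1) → ℝ) u * M u v) ∈
      nearRational M ψ T
        (Nat.log 2 q, Fin.cons (q : ℤ) fun u => round ((q : ℝ) * x u)) := by
  set k := Nat.log 2 q with hk
  have hkq : 2 ^ k ≤ q := Nat.pow_log_le_self 2 hq.ne'
  have hqk : q < 2 ^ (k + 1) := Nat.lt_pow_succ_log_self (by norm_num) q
  have hψk : ψ q ≤ ψ (2 ^ k) := hmono hkq
  refine ⟨⟨x, rfl⟩, hT _ _ (fun u => ?_) (fun v => ?_), ?_, fun u => ?_⟩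
  · dsimp only
    refine Fin.cases ?_ (fun u => ?_) u
    · rw [Fin.cons_zero]
      constructor
      · have : (0 : ℤ) ≤ (2 ^ (k + 1) * (R + 1) : ℕ) := Int.natCast_nonneg _
        omega
      · exact_mod_cast hqk.trans_le (Nat.le_mul_of_pos_right _ (Nat.succ_pos R))
    · rw [Fin.cons_succ]
      have hr := abs_le.mp (abs_sub_round ((q : ℝ) * x u))
      have hqR : |(q : ℝ) * x u| ≤ q * R := by
        rw [abs_mul, Nat.abs_cast]
        exact mul_le_mul_of_nonneg_left (hxR u) (Nat.cast_nonneg _)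
      have hqR' := abs_le.mp hqR
      have hN : (q : ℝ) * R + 1 ≤ ((2 ^ (k + 1) * (R + 1) : ℕ) : ℝ) := by
        have : q * R + 1 ≤ 2 ^ (k + 1) * (R + 1) := by nlinarith
        exact_mod_cast this
      constructor
      · have : (-((2 ^ (k + 1) * (R + 1) : ℕ) : ℝ)) ≤ (round ((q : ℝ) * x u) : ℝ) := by linarith
        exact_mod_cast this
      · have : (round ((q : ℝ) * x u) : ℝ) < ((2 ^ (k + 1) * (R + 1) : ℕ) : ℝ) := by linarith
        exact_mod_cast this
  · refine (dNI_le_abs_sub_add _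
      ((q : ℝ) * ∑ u, (Fin.cons (1 : ℝ) x : Fin (d + 1) → ℝ) u * M u v)).trans ?_
    have h3 : |∑ u, (((Fin.cons (q : ℤ) fun u => round ((q : ℝ) * x u) : Fin (d + 1) → ℤ) u : ℤ) :
        ℝ) * M u v - (q : ℝ) * ∑ u, (Fin.cons (1 : ℝ) x : Fin (d + 1) → ℝ) u * M u v| ≤
        (∑ v, ∑ u, |M u v|) * ψ q := by
      rw [Finset.mul_sum, ← Finset.sum_sub_distrib]
      simp_rw [← mul_assoc, ← sub_mul]
      have hle : ∑ u, |M u v| ≤ ∑ v, ∑ u, |M u v| :=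
        Finset.single_le_sum (f := fun v => ∑ u, |M u v|)
          (fun v _ => Finset.sum_nonneg fun u _ => abs_nonneg _) (Finset.mem_univ v)
      refine (Finset.abs_sum_le_sum_abs _ _).trans ?_
      refine le_trans (Finset.sum_le_sum fun u _ => ?_)
        ((le_of_eq (Finset.sum_mul _ _ _).symm).trans (mul_le_mul_of_nonneg_right hle (hψ q)))
      rw [abs_mul, mul_comm]
      refine mul_le_mul_of_nonneg_left ?_ (abs_nonneg _)
      refine Fin.cases ?_ (fun u => ?_) u
      · simpa using hψ q
      · rw [Fin.cons_succ, Fin.cons_succ, abs_sub_comm]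
        exact (h1 u).le
    have h4 : 0 ≤ 1 + ∑ v, ∑ u, |M u v| := by positivity
    calc _ ≤ (∑ v, ∑ u, |M u v|) * ψ q + ψ q := add_le_add h3 (h2 v).le
      _ = (1 + ∑ v, ∑ u, |M u v|) * ψ q := by ring
      _ ≤ _ := mul_le_mul_of_nonneg_left hψk h4
  · dsimp only
    rw [Fin.cons_zero]
    exact_mod_cast hkq
  · simp only [Fin.cons_zero, Fin.cons_succ, Int.cast_natCast]
    exact (h1 u).le.trans hψk

/-- The convergence statement in the coordinates of `ℝ^d × ℝ^m`. -/
lemma hausdorffMeasure_wellApproximable_affine_eq_zero {d m : ℕ}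
    (M : Matrix (Fin (d + 1)) (Fin m) ℝ) {s : ℝ} (hs : 0 < s) (hsd : s ≤ d) {ψ : ℕ → ℝ}
    (hψ : ∀ q, 0 ≤ ψ q) (hmono : Antitone ψ)
    (hsum : Summable fun q : ℕ => ψ q ^ ((m : ℝ) + s) * (q : ℝ) ^ ((d : ℝ) - s))
    (hω : multType M < ENNReal.ofReal (((d : ℝ) + 1) * ((m : ℝ) + s) / ((d : ℝ) + 1 - s))) :
    μH[s] {p : (Fin d → ℝ) × (Fin m → ℝ) |
      (∃ x : Fin d → ℝ,
        p = (x, fun v => ∑ u, (Fin.cons (1 : ℝ) x : Fin (d + 1) → ℝ) u * M u v)) ∧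
      {q : ℕ | 0 < q ∧ (∀ i, dNI ((q : ℝ) * p.1 i) < ψ q) ∧
        (∀ v, dNI ((q : ℝ) * p.2 v) < ψ q)}.Infinite} = 0 := by
  classical
  set E := {p : (Fin d → ℝ) × (Fin m → ℝ) |
      (∃ x : Fin d → ℝ,
        p = (x, fun v => ∑ u, (Fin.cons (1 : ℝ) x : Fin (d + 1) → ℝ) u * M u v)) ∧
      {q : ℕ | 0 < q ∧ (∀ i, dNI ((q : ℝ) * p.1 i) < ψ q) ∧
        (∀ v, dNI ((q : ℝ) * p.2 v) < ψ q)}.Infinite} with hE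
  have hEU : E ⊆ ⋃ R : ℕ, {p ∈ E | ∀ u, |p.1 u| ≤ R} := by
    intro p hp
    obtain ⟨R, hR⟩ := exists_nat_ge (∑ u, |p.1 u|)
    refine Set.mem_iUnion.mpr ⟨R, hp, fun u => le_trans ?_ hR⟩
    exact Finset.single_le_sum (f := fun u => |p.1 u|) (fun u _ => abs_nonneg _)
      (Finset.mem_univ u)
  refine measure_mono_null hEU (measure_iUnion_null fun R => ?_)
  obtain ⟨ω, hω0, hωlt, C, hC, hcount⟩ := exists_card_le M hω
  set D : ℝ := (d : ℝ) + 1 with hD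
  set a : ℝ := (m : ℝ) + s with ha
  have ha0 : 0 < a := by positivity
  have hDs : 0 < D - s := by linarith
  set η : ℝ := D / ω with hη
  have hηlt : D - s < η * a := by
    rw [lt_div_iff₀ hDs] at hωlt
    rw [hη, div_mul_eq_mul_div, lt_div_iff₀ hω0]
    linarith
  have hsum₁ : Summable fun k : ℕ => ψ (2 ^ k) ^ a * ((2 : ℝ) ^ k) ^ (D - s) := by
    have h := summable_condensed_rpow hψ hmono ha0.le (sub_nonneg.mpr hsd) hsum
    have e : (d : ℝ) - s + 1 = D - s := by ring
    rwa [e] at h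
  have hsum₂ := summable_condensed_add_rpow hψ ha0.le hηlt hsum₁
  set ρ : ℕ → ℝ := fun k => ψ (2 ^ k) + ((2 : ℝ) ^ k) ^ (-η) with hρ
  have hρη : ∀ k, ((2 : ℝ) ^ k) ^ (-η) ≤ ρ k := fun k => le_add_of_nonneg_left (hψ _)
  have hρψ : ∀ k, ψ (2 ^ k) ≤ ρ k := fun k => le_add_of_nonneg_right (by positivity)
  have hρ0 : ∀ k, 0 < ρ k := fun k => lt_of_lt_of_le (by positivity) (hρη k)
  set C₁ := 1 + ∑ v, ∑ u, |M u v| with hC₁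
  have hC₁1 : 1 ≤ C₁ := by
    have : 0 ≤ ∑ v, ∑ u, |M u v| :=
      Finset.sum_nonneg fun v _ => Finset.sum_nonneg fun u _ => abs_nonneg _
    linarith
  set N : ℕ → ℕ := fun k => 2 ^ (k + 1) * (R + 1) with hN
  set T : ℕ → Finset (Fin (d + 1) → ℤ) := fun k =>
    (Fintype.piFinset fun _ : Fin (d + 1) => Finset.Ico (-(N k : ℤ)) (N k)).filter
      fun r => ∀ v, dNI (∑ u, (r u : ℝ) * M u v) ≤ C₁ * ρ k with hT
  have hcard : ∀ k, ((T k).card : ℝ) ≤ C * (C₁ * ρ k) ^ m * (N k : ℝ) ^ (d + 1) := by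
    intro k
    have hρk := hρ0 k
    refine hcount (C₁ * ρ k) (by positivity) (N k) ?_
    have h2k : (0 : ℝ) < 2 ^ k := by positivity
    have h1 : ((2 : ℝ) ^ k) ^ (-η) ≤ C₁ * ρ k :=
      (hρη k).trans (le_mul_of_one_le_left hρk.le hC₁1)
    have h2 : (C₁ * ρ k)⁻¹ ≤ ((2 : ℝ) ^ k) ^ η := by
      rw [Real.rpow_neg h2k.le] at h1
      exact inv_le_of_inv_le₀ (by positivity) h1
    calc ((C₁ * ρ k)⁻¹) ^ ω ≤ (((2 : ℝ) ^ k) ^ η) ^ ω :=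
          Real.rpow_le_rpow (by positivity) h2 hω0.le
      _ = ((2 : ℝ) ^ k) ^ (d + 1) := by
          rw [← Real.rpow_mul h2k.le, hη, div_mul_cancel₀ _ hω0.ne', hD,
            ← Real.rpow_natCast _ (d + 1)]
          push_cast
          rfl
      _ ≤ (N k : ℝ) ^ (d + 1) := by
          refine pow_le_pow_left₀ h2k.le ?_ _
          have : 2 ^ k ≤ N k := by
            simp only [hN, pow_succ]
            nlinarith [Nat.zero_le (2 ^ k * R), Nat.zero_le (2 ^ k)]
          exact_mod_cast this
  set K : ℝ := C * C₁ ^ m * (2 * (R + 1)) ^ (d + 1) * (C₁ * 2) ^ s with hK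
  have hbound : ∀ k, ∑' r, Metric.ediam (nearRational M ψ T (k, r)) ^ s ≤
      ENNReal.ofReal (K * (ρ k ^ a * ((2 : ℝ) ^ k) ^ (D - s))) := by
    intro k
    have hρk := hρ0 k
    have hzero : ∀ r ∉ T k, Metric.ediam (nearRational M ψ T (k, r)) ^ s = 0 := by
      intro r hr
      have : nearRational M ψ T (k, r) = ∅ :=
        Set.eq_empty_of_forall_notMem fun p hp => hr hp.2.1
      rw [this, Metric.ediam_empty, ENNReal.zero_rpow_of_pos hs]
    rw [tsum_eq_sum hzero]
    have hterm : ∀ r ∈ T k, Metric.ediam (nearRational M ψ T (k, r)) ^ s ≤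
        ENNReal.ofReal ((C₁ * (2 * ρ k / 2 ^ k)) ^ s) := by
      intro r _
      rw [← ENNReal.ofReal_rpow_of_nonneg (by positivity) hs.le]
      refine ENNReal.rpow_le_rpow ((ediam_nearRational_le M hψ T (k, r)).trans
        (ENNReal.ofReal_le_ofReal ?_)) hs.le
      have := hρψ k
      dsimp only
      gcongr
    refine (Finset.sum_le_card_nsmul _ _ _ hterm).trans ?_
    rw [nsmul_eq_mul, ← ENNReal.ofReal_natCast, ← ENNReal.ofReal_mul (Nat.cast_nonneg _)]
    refine ENNReal.ofReal_le_ofReal ?_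
    refine (mul_le_mul_of_nonneg_right (hcard k) (by positivity)).trans (le_of_eq ?_)
    have h2k : (0 : ℝ) < 2 ^ k := by positivity
    have e1 : (C₁ * (2 * ρ k / 2 ^ k)) ^ s = (C₁ * 2) ^ s * ρ k ^ s * (((2 : ℝ) ^ k) ^ s)⁻¹ := by
      rw [show C₁ * (2 * ρ k / 2 ^ k) = (C₁ * 2) * ρ k / 2 ^ k by ring,
        Real.div_rpow (by positivity) h2k.le, Real.mul_rpow (by positivity) hρk.le, div_eq_mul_inv]
    have e2 : ρ k ^ a = ρ k ^ m * ρ k ^ s := by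
      rw [ha, Real.rpow_add hρk, Real.rpow_natCast]
    have e3 : ((2 : ℝ) ^ k) ^ (D - s) = ((2 : ℝ) ^ k) ^ (d + 1) * (((2 : ℝ) ^ k) ^ s)⁻¹ := by
      rw [Real.rpow_sub h2k, hD, ← Real.rpow_natCast _ (d + 1), div_eq_mul_inv]
      push_cast
      rfl
    have e4 : (N k : ℝ) = 2 ^ k * (2 * (R + 1)) := by
      simp only [hN]; push_cast; ring
    rw [e1, e2, e3, e4, hK, mul_pow ((2 : ℝ) ^ k), mul_pow C₁]
    ring
  have htsum : ∑' i, Metric.ediam (nearRational M ψ T i) ^ s ≠ ∞ := by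
    rw [ENNReal.tsum_prod']
    exact ne_top_of_le_ne_top (hsum₂.mul_left K).tsum_ofReal_ne_top (ENNReal.tsum_le_tsum hbound)
  refine hausdorffMeasure_eq_zero_of_infinite_mem hs _ htsum fun p hp => ?_
  obtain ⟨⟨⟨x, rfl⟩, hinf⟩, hxR⟩ := hp
  refine Set.infinite_of_injOn_mapsTo
    (f := fun q : ℕ => ((Nat.log 2 q, Fin.cons (q : ℤ) fun u => round ((q : ℝ) * x u)) :
      ℕ × (Fin (d + 1) → ℤ))) (fun q _ q' _ h => ?_) (fun q hq => ?_) hinf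
  · have h0 := congrFun (Prod.mk.inj h).2 0
    simpa using h0
  · refine exists_mem_nearRational M hψ hmono R T (fun k r hr1 hr2 => ?_) x hxR q hq.1 hq.2.1 hq.2.2
    rw [hT, Finset.mem_filter, Fintype.mem_piFinset]
    refine ⟨fun u => Finset.mem_Ico.mpr (hr1 u), fun v => (hr2 v).trans ?_⟩
    exact mul_le_mul_of_nonneg_left (hρψ k) (by linarith)

/-- Theorem 2 of the paper: the convergence case of the generalized
Baker–Schmidt problem for an affine subspace, with no monotonicity on `ψ`.
We realize `ℝ^n` as `ℝ^d × ℝ^{n-d}` (with the sup metric, which is the metric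
of `ℝ^n` with the sup norm), and `H` as the set of points `(x, (1,x)·Ã)`. -/
theorem Jarnik_type_for_convergence
    (n d : ℕ) (hd : 1 ≤ d) (hdn : d < n)
    (α₀ : Fin (n - d) → ℝ) (A : Matrix (Fin d) (Fin (n - d)) ℝ)
    (Atil : Matrix (Fin (d + 1)) (Fin (n - d)) ℝ)
    (hAtil : Atil = Matrix.of (Fin.cons α₀ A))
    (s : ℝ) (hs : 0 < s) (hsd : s ≤ d)
    (ψ : ℕ → ℝ) (hψ : ∀ q, 0 ≤ ψ q) (hmono : Antitone ψ)
    (hsum : Summable fun q : ℕ => ψ q ^ ((n : ℝ) - d + s) * (q : ℝ) ^ ((d : ℝ) - s))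
    (hω : multType Atil < ENNReal.ofReal (((d : ℝ) + 1) * ((n : ℝ) - d + s) / ((d : ℝ) + 1 - s))) :
    μH[s] {p : (Fin d → ℝ) × (Fin (n - d) → ℝ) |
      (∃ x : Fin d → ℝ, p = (x, fun v => ∑ u, (Fin.cons (1 : ℝ) x : Fin (d+1) → ℝ) u * Atil u v)) ∧
      {q : ℕ | 0 < q ∧ (∀ i, dNI ((q : ℝ) * p.1 i) < ψ q) ∧
        (∀ v, dNI ((q : ℝ) * p.2 v) < ψ q)}.Infinite} = 0 := by
  have hcast : (n : ℝ) - d = ((n - d : ℕ) : ℝ) := (Nat.cast_sub hdn.le).symm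
  rw [hcast] at hsum hω
  exact hausdorffMeasure_wellApproximable_affine_eq_zero Atil hs hsd hψ hmono hsum hω
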